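/- Fix real constants a,b,c. Let T = q1⁴(q1/2+q2)p1²/(q1−q2) + q2⁴(q1+q2/2)p2²/(q2−q1), V = a(q1²+3q1q2+q2²)(3q1²+8q1q2+3q2²)/(q1⁴q2⁴) + b(q1²+3q1q2+q2²)/(q1²q2²) + c q1²q2²/(q1+q2)², K1 = q1²(2q1+3q2)p1 − q2²(3q1+2q2)p2, K2 = q1²q2²(q1²p1−q2²p2)²/((q1−q2)³·(nothing)), precisely K2 = q1²q2²(q1²p1−q2²p2)²/(q1−q2)³ divided so that K = K1·K2 with K = q1²q2²(q1²p1−q2²p2)²(q1²(2q1+3q2)p1−q2²(3q1+2q2)p2)/(q1−q2)³; i.e. K2 = q1²q2²(q1²p1−q2²p2)²/(q1−q2)³. Let U1 = −2a(q1−q2)²(q1²+3q1q2+q2²)²/(q1⁴q2⁴) − 2c q1²q2²(q1−q2)²/(q1+q2)², U2 = 2a(q1²+4q1q2+q2²)/(q1²q2²(q1−q2)) + 2b/(q1−q2). Then H1 = T+V and H2 = (K1²+U1)(K2+U2)² satisfy {H1,H2} = 0 on the open set where q1,q2,q1−q2,q1+q2 are nonzero. -/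

import Mathlib

/-- Canonical Poisson bracket of two functions on phase space (q1,q2,p1,p2). -/
noncomputable def pb (f g : ℝ → ℝ → ℝ → ℝ → ℝ) (q1 q2 p1 p2 : ℝ) : ℝ :=
  (deriv (fun x => f x q2 p1 p2) q1) * (deriv (fun x => g q1 q2 x p2) p1)
  - (deriv (fun x => f q1 q2 x p2) p1) * (deriv (fun x => g x q2 p1 p2) q1)
  + (deriv (fun x => f q1 x p1 p2) q2) * (deriv (fun x => g q1 q2 p1 x) p2)
  - (deriv (fun x => f q1 q2 p1 x) p2) * (deriv (fun x => g q1 x p1 p2) q2)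

noncomputable def H1 (a b c q1 q2 p1 p2 : ℝ) : ℝ :=
  q1^4 * (q1/2 + q2) * p1^2 / (q1 - q2) + q2^4 * (q1 + q2/2) * p2^2 / (q2 - q1)
  + a * (q1^2 + 3*q1*q2 + q2^2) * (3*q1^2 + 8*q1*q2 + 3*q2^2) / (q1^4*q2^4)
  + b * (q1^2 + 3*q1*q2 + q2^2) / (q1^2*q2^2)
  + c * q1^2*q2^2 / (q1 + q2)^2

noncomputable def H2 (a b c q1 q2 p1 p2 : ℝ) : ℝ :=
  ((q1^2*(2*q1 + 3*q2)*p1 - q2^2*(3*q1 + 2*q2)*p2)^2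
    + (-2*a*(q1 - q2)^2*(q1^2 + 3*q1*q2 + q2^2)^2/(q1^4*q2^4)
        - 2*c*q1^2*q2^2*(q1 - q2)^2/(q1 + q2)^2))
  * (q1^2*q2^2*(q1^2*p1 - q2^2*p2)^2/(q1 - q2)^3
    + (2*a*(q1^2 + 4*q1*q2 + q2^2)/(q1^2*q2^2*(q1 - q2)) + 2*b/(q1 - q2)))^2

/-- The quadratic-in-momenta factor of `H2`. -/
noncomputable def quadFactor (a c q1 q2 p1 p2 : ℝ) : ℝ :=
  (q1^2*(2*q1 + 3*q2)*p1 - q2^2*(3*q1 + 2*q2)*p2)^2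
    + (-2*a*(q1 - q2)^2*(q1^2 + 3*q1*q2 + q2^2)^2/(q1^4*q2^4)
        - 2*c*q1^2*q2^2*(q1 - q2)^2/(q1 + q2)^2)

/-- The factor of `H2` that enters it squared. -/
noncomputable def squareFactor (a b q1 q2 p1 p2 : ℝ) : ℝ :=
  q1^2*q2^2*(q1^2*p1 - q2^2*p2)^2/(q1 - q2)^3
    + (2*a*(q1^2 + 4*q1*q2 + q2^2)/(q1^2*q2^2*(q1 - q2)) + 2*b/(q1 - q2))

theorem H2_eq (a b c q1 q2 p1 p2 : ℝ) :
    H2 a b c q1 q2 p1 p2 = quadFactor a c q1 q2 p1 p2 * squareFactor a b q1 q2 p1 p2 ^ 2 := rfl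

theorem H1_swap (a b c q1 q2 p1 p2 : ℝ) : H1 a b c q1 q2 p1 p2 = H1 a b c q2 q1 p2 p1 := by
  unfold H1; ring

theorem quadFactor_swap (a c q1 q2 p1 p2 : ℝ) :
    quadFactor a c q1 q2 p1 p2 = quadFactor a c q2 q1 p2 p1 := by
  unfold quadFactor; ring

theorem squareFactor_swap (a b q1 q2 p1 p2 : ℝ) :
    squareFactor a b q1 q2 p1 p2 = -squareFactor a b q2 q1 p2 p1 := by
  have h : q1 - q2 = -(q2 - q1) := by ring
  unfold squareFactor
  rw [h, show (-(q2 - q1)) ^ 3 = -(q2 - q1) ^ 3 by ring, mul_neg, div_neg, div_neg, div_neg]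
  ring

/-- The `q1`-derivative of `H1`. -/
noncomputable def H1q (a b c q1 q2 p1 p2 : ℝ) : ℝ :=
  ((4*q1^3*(q1/2 + q2) + q1^4/2)*(q1 - q2) - q1^4*(q1/2 + q2))*p1^2/(q1 - q2)^2
  + (q2^4*(q2 - q1) + q2^4*(q1 + q2/2))*p2^2/(q2 - q1)^2
  + a*(((2*q1 + 3*q2)*(3*q1^2 + 8*q1*q2 + 3*q2^2)
      + (q1^2 + 3*q1*q2 + q2^2)*(6*q1 + 8*q2))*q1
      - 4*(q1^2 + 3*q1*q2 + q2^2)*(3*q1^2 + 8*q1*q2 + 3*q2^2))/(q1^5*q2^4)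
  + b*((2*q1 + 3*q2)*q1 - 2*(q1^2 + 3*q1*q2 + q2^2))/(q1^3*q2^2)
  + 2*c*q1*q2^3/(q1 + q2)^3

/-- The `q1`-derivative of `quadFactor`. -/
noncomputable def quadFactorq (a c q1 q2 p1 p2 : ℝ) : ℝ :=
  2*(q1^2*(2*q1 + 3*q2)*p1 - q2^2*(3*q1 + 2*q2)*p2)*((6*q1^2 + 6*q1*q2)*p1 - 3*q2^2*p2)
  - 4*a*(q1 - q2)*(q1^2 + 3*q1*q2 + q2^2)*
      ((q1^2 + 3*q1*q2 + q2^2)*q1 + (q1 - q2)*(2*q1 + 3*q2)*q1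
        - 2*(q1 - q2)*(q1^2 + 3*q1*q2 + q2^2))/(q1^5*q2^4)
  - 4*c*q1*q2^2*(q1 - q2)*((q1 - q2)*(q1 + q2) + q1*(q1 + q2) - q1*(q1 - q2))/(q1 + q2)^3

/-- The `q1`-derivative of `squareFactor`. -/
noncomputable def squareFactorq (a b q1 q2 p1 p2 : ℝ) : ℝ :=
  q1*q2^2*(q1^2*p1 - q2^2*p2)*
      (2*(q1^2*p1 - q2^2*p2)*(q1 - q2) + 4*q1^2*p1*(q1 - q2)
        - 3*q1*(q1^2*p1 - q2^2*p2))/(q1 - q2)^4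
  + 2*a*((2*q1 + 4*q2)*q1*(q1 - q2)
      - (q1^2 + 4*q1*q2 + q2^2)*(2*(q1 - q2) + q1))/(q1^3*q2^2*(q1 - q2)^2)
  - 2*b/(q1 - q2)^2

section Derivatives

variable {q1 q2 : ℝ}

theorem hasDerivAt_H1_q (a b c p1 p2 : ℝ) (h1 : q1 ≠ 0) (h2 : q2 ≠ 0)
    (h3 : q1 ≠ q2) (h4 : q1 + q2 ≠ 0) :
    HasDerivAt (fun x => H1 a b c x q2 p1 p2) (H1q a b c q1 q2 p1 p2) q1 := by
  have d : q1 - q2 ≠ 0 := sub_ne_zero.2 h3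
  have d' : q2 - q1 ≠ 0 := sub_ne_zero.2 h3.symm
  have X := hasDerivAt_id' q1
  have S := ((X.fun_pow 2).fun_add ((X.const_mul 3).mul_const q2)).add_const (q2^2)
  have R := (((X.fun_pow 2).const_mul 3).fun_add ((X.const_mul 8).mul_const q2)).add_const (3*q2^2)
  have t1 := (((X.fun_pow 4).fun_mul ((X.div_const 2).add_const q2)).mul_const (p1^2)).fun_div
    (X.sub_const q2) d
  have t2 := (((X.add_const (q2/2)).const_mul (q2^4)).mul_const (p2^2)).fun_div
    (X.const_sub q2) d'
  have t3 := ((S.const_mul a).fun_mul R).fun_div ((X.fun_pow 4).mul_const (q2^4)) (by positivity)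
  have t4 := (S.const_mul b).fun_div ((X.fun_pow 2).mul_const (q2^2)) (by positivity)
  have t5 := (((X.fun_pow 2).const_mul c).mul_const (q2^2)).fun_div
    ((X.add_const q2).fun_pow 2) (by positivity)
  refine ((((t1.fun_add t2).fun_add t3).fun_add t4).fun_add t5).congr_deriv ?_
  unfold H1q
  congr 1
  · congr 1
    · congr 1
      · congr 1 <;> · field_simp; ring
      · field_simp; ring
    · field_simp; ring
  · field_simp; ring

theorem hasDerivAt_quadFactor_q (a c p1 p2 : ℝ) (h1 : q1 ≠ 0) (h2 : q2 ≠ 0)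
    (h4 : q1 + q2 ≠ 0) :
    HasDerivAt (fun x => quadFactor a c x q2 p1 p2) (quadFactorq a c q1 q2 p1 p2) q1 := by
  have X := hasDerivAt_id' q1
  have S := ((X.fun_pow 2).fun_add ((X.const_mul 3).mul_const q2)).add_const (q2^2)
  have t1 := ((((X.fun_pow 2).fun_mul ((X.const_mul 2).add_const (3*q2))).mul_const p1).fun_sub
    ((((X.const_mul 3).add_const (2*q2)).const_mul (q2^2)).mul_const p2)).fun_pow 2
  have t2 := ((((X.sub_const q2).fun_pow 2).const_mul (-2*a)).fun_mul (S.fun_pow 2)).fun_div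
    ((X.fun_pow 4).mul_const (q2^4)) (by positivity)
  have t3 := ((((X.fun_pow 2).const_mul (2*c)).mul_const (q2^2)).fun_mul
    ((X.sub_const q2).fun_pow 2)).fun_div ((X.add_const q2).fun_pow 2) (by positivity)
  refine (t1.fun_add (t2.fun_sub t3)).congr_deriv ?_
  unfold quadFactorq
  rw [← add_sub_assoc, sub_eq_add_neg _ (4*a*_*_*_/_)]
  congr 1
  · congr 1
    · ring
    · field_simp; ring
  · field_simp; ring

theorem hasDerivAt_squareFactor_q (a b p1 p2 : ℝ) (h1 : q1 ≠ 0) (h2 : q2 ≠ 0)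
    (h3 : q1 ≠ q2) :
    HasDerivAt (fun x => squareFactor a b x q2 p1 p2) (squareFactorq a b q1 q2 p1 p2) q1 := by
  have d : q1 - q2 ≠ 0 := sub_ne_zero.2 h3
  have X := hasDerivAt_id' q1
  have D := X.sub_const q2
  have S := ((X.fun_pow 2).fun_add ((X.const_mul 4).mul_const q2)).add_const (q2^2)
  have t1 := (((X.fun_pow 2).mul_const (q2^2)).fun_mul
    ((((X.fun_pow 2).mul_const p1).sub_const (q2^2*p2)).fun_pow 2)).fun_div
    (D.fun_pow 3) (by positivity)
  have t2 := (S.const_mul (2*a)).fun_div (((X.fun_pow 2).mul_const (q2^2)).fun_mul D)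
    (by positivity)
  have t3 := (hasDerivAt_const q1 (2*b)).fun_div D d
  refine (t1.fun_add (t2.fun_add t3)).congr_deriv ?_
  unfold squareFactorq
  rw [← add_assoc, sub_eq_add_neg _ (2*b/_)]
  congr 1
  · congr 1 <;> · field_simp; ring
  · field_simp; ring

theorem hasDerivAt_H1_p (a b c q1 q2 p1 p2 : ℝ) :
    HasDerivAt (fun x => H1 a b c q1 q2 x p2) (q1^4*(q1 + 2*q2)*p1/(q1 - q2)) p1 := by
  refine (((((((hasDerivAt_id' p1).fun_pow 2).const_mul (q1^4*(q1/2 + q2))).div_const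
    (q1 - q2)).add_const _).add_const _).add_const _ |>.add_const _).congr_deriv ?_
  ring

theorem hasDerivAt_quadFactor_p (a c q1 q2 p1 p2 : ℝ) :
    HasDerivAt (fun x => quadFactor a c q1 q2 x p2)
      (2*(q1^2*(2*q1 + 3*q2)*p1 - q2^2*(3*q1 + 2*q2)*p2)*(q1^2*(2*q1 + 3*q2))) p1 := by
  refine (((((hasDerivAt_id' p1).const_mul (q1^2*(2*q1 + 3*q2))).sub_const _).fun_pow
    2).add_const _).congr_deriv ?_
  ring

theorem hasDerivAt_squareFactor_p (a b q1 q2 p1 p2 : ℝ) :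
    HasDerivAt (fun x => squareFactor a b q1 q2 x p2)
      (2*q1^4*q2^2*(q1^2*p1 - q2^2*p2)/(q1 - q2)^3) p1 := by
  refine (((((((hasDerivAt_id' p1).const_mul (q1^2)).sub_const _).fun_pow 2).const_mul
    (q1^2*q2^2)).div_const ((q1 - q2)^3)).add_const _).congr_deriv ?_
  ring

end Derivatives

/-- The function `s` with `{H1, quadFactor} = 2 * s * quadFactor` and
`{H1, squareFactor} = -s * squareFactor`. -/
noncomputable def cofactor (q1 q2 p1 p2 : ℝ) : ℝ :=
  -(q1^2 + q1*q2 + q2^2)*(q1^3*p1 + q2^3*p2)/(q1 - q2)^2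

theorem pb_eq_of_hasDerivAt {f g : ℝ → ℝ → ℝ → ℝ → ℝ} {q1 q2 p1 p2 a1 a2 a3 a4 b1 b2 b3 b4 : ℝ}
    (ha1 : HasDerivAt (fun x => f x q2 p1 p2) a1 q1)
    (ha2 : HasDerivAt (fun x => f q1 x p1 p2) a2 q2)
    (ha3 : HasDerivAt (fun x => f q1 q2 x p2) a3 p1)
    (ha4 : HasDerivAt (fun x => f q1 q2 p1 x) a4 p2)
    (hb1 : HasDerivAt (fun x => g x q2 p1 p2) b1 q1)
    (hb2 : HasDerivAt (fun x => g q1 x p1 p2) b2 q2)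
    (hb3 : HasDerivAt (fun x => g q1 q2 x p2) b3 p1)
    (hb4 : HasDerivAt (fun x => g q1 q2 p1 x) b4 p2) :
    pb f g q1 q2 p1 p2 = a1*b3 - a3*b1 + a2*b4 - a4*b2 := by
  rw [pb, ha1.deriv, ha2.deriv, ha3.deriv, ha4.deriv, hb1.deriv, hb2.deriv, hb3.deriv, hb4.deriv]

/-- The bracket of `H1` with `quadFactor`, in terms of the partial derivatives. -/
theorem bracket_H1_quadFactor (a b c : ℝ) {q1 q2 : ℝ} (p1 p2 : ℝ) (h1 : q1 ≠ 0) (h2 : q2 ≠ 0)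
    (h3 : q1 ≠ q2) (h4 : q1 + q2 ≠ 0) :
    H1q a b c q1 q2 p1 p2 *
        (2*(q1^2*(2*q1 + 3*q2)*p1 - q2^2*(3*q1 + 2*q2)*p2)*(q1^2*(2*q1 + 3*q2)))
      - q1^4*(q1 + 2*q2)*p1/(q1 - q2) * quadFactorq a c q1 q2 p1 p2
      + H1q a b c q2 q1 p2 p1 *
        (2*(q2^2*(2*q2 + 3*q1)*p2 - q1^2*(3*q2 + 2*q1)*p1)*(q2^2*(2*q2 + 3*q1)))
      - q2^4*(q2 + 2*q1)*p2/(q2 - q1) * quadFactorq a c q2 q1 p2 p1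
      = 2*cofactor q1 q2 p1 p2*quadFactor a c q1 q2 p1 p2 := by
  have d : q1 - q2 ≠ 0 := sub_ne_zero.2 h3
  have e : q2 - q1 = -(q1 - q2) := by ring
  have e' : q2 + q1 = q1 + q2 := by ring
  unfold H1q quadFactorq quadFactor cofactor
  simp only [e, e', neg_sq, div_neg]
  field_simp
  ring

theorem bracket_H1_squareFactor (a b c : ℝ) {q1 q2 : ℝ} (p1 p2 : ℝ) (h1 : q1 ≠ 0) (h2 : q2 ≠ 0)
    (h3 : q1 ≠ q2) (h4 : q1 + q2 ≠ 0) :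
    H1q a b c q1 q2 p1 p2 * (2*q1^4*q2^2*(q1^2*p1 - q2^2*p2)/(q1 - q2)^3)
      - q1^4*(q1 + 2*q2)*p1/(q1 - q2) * squareFactorq a b q1 q2 p1 p2
      + H1q a b c q2 q1 p2 p1 * -(2*q2^4*q1^2*(q2^2*p2 - q1^2*p1)/(q2 - q1)^3)
      - q2^4*(q2 + 2*q1)*p2/(q2 - q1) * -squareFactorq a b q2 q1 p2 p1
      = -cofactor q1 q2 p1 p2*squareFactor a b q1 q2 p1 p2 := by
  have d : q1 - q2 ≠ 0 := sub_ne_zero.2 h3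
  have e : q2 - q1 = -(q1 - q2) := by ring
  have e' : q2 + q1 = q1 + q2 := by ring
  have e3 : (-(q1 - q2))^3 = -(q1 - q2)^3 := by ring
  have e4 : (-(q1 - q2))^4 = (q1 - q2)^4 := by ring
  unfold H1q squareFactorq squareFactor cofactor
  simp only [e, e', e3, e4, neg_sq, div_neg]
  field_simp
  ring

theorem HasDerivAt.mul_sq {u v : ℝ → ℝ} {u' v' x : ℝ} (hu : HasDerivAt u u' x)
    (hv : HasDerivAt v v' x) :
    HasDerivAt (fun x => u x * v x ^ 2) (u'*v x^2 + 2*u x*v x*v') x :=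
  (hu.fun_mul (hv.fun_pow 2)).congr_deriv (by ring)

theorem stmt18 (a b c q1 q2 p1 p2 : ℝ) (h1 : q1 ≠ 0) (h2 : q2 ≠ 0)
    (h3 : q1 ≠ q2) (h4 : q1 + q2 ≠ 0) :
    pb (H1 a b c) (H2 a b c) q1 q2 p1 p2 = 0 := by
  have h4' : q2 + q1 ≠ 0 := by rwa [add_comm]
  have f1 := hasDerivAt_H1_q a b c p1 p2 h1 h2 h3 h4
  have f2 := hasDerivAt_H1_q a b c p2 p1 h2 h1 h3.symm h4'
  have f3 := hasDerivAt_H1_p a b c q1 q2 p1 p2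
  have f4 := hasDerivAt_H1_p a b c q2 q1 p2 p1
  have u1 := hasDerivAt_quadFactor_q a c p1 p2 h1 h2 h4
  have u2 := hasDerivAt_quadFactor_q a c p2 p1 h2 h1 h4'
  have u3 := hasDerivAt_quadFactor_p a c q1 q2 p1 p2
  have u4 := hasDerivAt_quadFactor_p a c q2 q1 p2 p1
  have v1 := hasDerivAt_squareFactor_q a b p1 p2 h1 h2 h3
  have v2 := (hasDerivAt_squareFactor_q a b p2 p1 h2 h1 h3.symm).fun_neg
  have v3 := hasDerivAt_squareFactor_p a b q1 q2 p1 p2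
  have v4 := (hasDerivAt_squareFactor_p a b q2 q1 p2 p1).fun_neg
  simp only [H1_swap a b c _ q1 _ p1] at f2 f4
  simp only [quadFactor_swap a c _ q1 _ p1] at u2 u4
  simp only [← squareFactor_swap] at v2 v4
  have hu := bracket_H1_quadFactor a b c p1 p2 h1 h2 h3 h4
  have hv := bracket_H1_squareFactor a b c p1 p2 h1 h2 h3 h4
  rw [pb_eq_of_hasDerivAt f1 f2 f3 f4 (u1.mul_sq v1) (u2.mul_sq v2) (u3.mul_sq v3) (u4.mul_sq v4)]
  linear_combination squareFactor a b q1 q2 p1 p2 ^ 2 * hu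
    + 2*quadFactor a c q1 q2 p1 p2*squareFactor a b q1 q2 p1 p2 * hv
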